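/- (Upper bound of maximum resilience) Fix N ≥ 3 and K with N − 1 ≤ K ≤ N(N−1)/2. Then the N-node system is not K-resilient: there exists A ⊆ P with |A| = K (namely any A containing all N − 1 pairs involving node 1) such that for every e : P → ℝ supported on A with e p ≠ 0 for all p ∈ A and every δ : Fin N → ℝ with δ 0 = 0, the equation system for (A, D δ + e) has at least two distinct solutions; in particular the uniqueness requirement of the K-resilience condition fails. -/

import Mathlib

/-- The peer-to-peer synchronization sessions: ordered pairs `(i, j)` of nodes with `j < i`. -/
abbrev Pair (N : ℕ) := {p : Fin N × Fin N // p.2 < p.1}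

/-- The difference map `(D δ) (i, j) = δ i - δ j`. -/
def Dmap {N : ℕ} (δ : Fin N → ℝ) : Pair N → ℝ := fun p => δ p.1.1 - δ p.1.2

/-- The indicator vector of a pair `a`. -/
def ind {N : ℕ} (a : Pair N) : Pair N → ℝ := fun p => if p = a then 1 else 0

/-- `(dh, eh)` is a solution of the equation system for the assumed fault set `E`
and measurements `b`: `dh 0 = 0`, `eh` is supported on `E`, and `D dh + eh = b`. -/
def IsSolution {N : ℕ} (hN : 0 < N) (E : Set (Pair N)) (b : Pair N → ℝ)
    (dh : Fin N → ℝ) (eh : Pair N → ℝ) : Prop :=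
  dh ⟨0, hN⟩ = 0 ∧ (∀ p ∉ E, eh p = 0) ∧ ∀ p, Dmap dh p + eh p = b p

theorem card_pair (N : ℕ) : Fintype.card (Pair N) = N * (N - 1) / 2 := by
  let f : Pair N ≃ (Σ i : Fin N, Fin i) :=
    { toFun := fun p => ⟨p.1.1, ⟨p.1.2, p.2⟩⟩
      invFun := fun q => ⟨(q.1, ⟨q.2, q.2.2.trans q.1.2⟩), q.2.2⟩
      left_inv := fun _ => rfl
      right_inv := fun _ => rfl }
  rw [Fintype.card_congr f, Fintype.card_sigma, ← Finset.sum_range_id]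
  simp only [Fintype.card_fin]
  exact Fin.sum_univ_eq_sum_range (fun i => i) N

/-- A node belongs to at most `N - 1` pairs. -/
theorem card_pairs_at_le {N : ℕ} (a : Fin N) :
    (Finset.univ.filter fun p : Pair N => p.1.1 = a ∨ p.1.2 = a).card ≤ N - 1 := by
  have h : (Finset.univ.erase a).card = N - 1 := by simp
  rw [← h]
  refine Finset.card_le_card_of_injOn (fun p => if p.1.1 = a then p.1.2 else p.1.1) ?_ ?_
  · rintro ⟨⟨i, j⟩, hij⟩ hp
    have hij' : j < i := hij
    simp at hp ⊢
    split_ifs with hi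
    · exact fun hj => hij'.ne (hj.trans hi.symm)
    · exact hi
  · rintro ⟨⟨i, j⟩, hij⟩ hp ⟨⟨k, l⟩, hkl⟩ hq hpq
    have hij' : j < i := hij
    have hkl' : l < k := hkl
    simp at hp hq hpq ⊢
    grind

/-- If `E` contains all pairs at a node other than the reference, the offset of that node can be
shifted arbitrarily in a solution. -/
theorem IsSolution.shift {N : ℕ} {hN : 0 < N} {E : Set (Pair N)} {b : Pair N → ℝ}
    {dh : Fin N → ℝ} {eh : Pair N → ℝ} (h : IsSolution hN E b dh eh) {a : Fin N}
    (ha : a ≠ ⟨0, hN⟩) (hE : ∀ p : Pair N, p.1.1 = a ∨ p.1.2 = a → p ∈ E) (t : ℝ) :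
    IsSolution hN E b (dh + Pi.single a t) (eh - Dmap (Pi.single a t)) := by
  obtain ⟨h0, hs, hb⟩ := h
  refine ⟨by simp [h0, ha.symm], fun p hp => ?_, fun p => ?_⟩
  · have hpa := mt (hE p) hp
    push Not at hpa
    simp [Dmap, hs p hp, hpa.1, hpa.2]
  · rw [← hb p]
    simp only [Dmap, Pi.add_apply, Pi.sub_apply]
    ring

/-- Upper bound of maximum resilience: for `N ≥ 3` and `N - 1 ≤ K ≤ N(N-1)/2`, the
`N`-node system is not `K`-resilient: there is a fault set `A` of size `K` (containing
all pairs involving node 1) such that for every fault vector supported and nonzero on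
`A` and every `δ` with `δ 0 = 0`, the equation system for `(A, D δ + e)` has at least
two distinct solutions, so uniqueness fails. -/
theorem stmt_14 {N : ℕ} (hN : 3 ≤ N) (K : ℕ) (hK1 : N - 1 ≤ K)
    (hK2 : K ≤ N * (N - 1) / 2) :
    ∃ A : Set (Pair N), A.ncard = K ∧
      (∀ p : Pair N,
        (p.1.1 = (⟨1, by omega⟩ : Fin N) ∨ p.1.2 = (⟨1, by omega⟩ : Fin N)) → p ∈ A) ∧
      ∀ e : Pair N → ℝ, (∀ p ∉ A, e p = 0) → (∀ p ∈ A, e p ≠ 0) →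
      ∀ δ : Fin N → ℝ, δ ⟨0, by omega⟩ = 0 →
        ∃ s₁ s₂ : (Fin N → ℝ) × (Pair N → ℝ), s₁ ≠ s₂ ∧
          IsSolution (show 0 < N by omega) A (fun p => Dmap δ p + e p) s₁.1 s₁.2 ∧
          IsSolution (show 0 < N by omega) A (fun p => Dmap δ p + e p) s₂.1 s₂.2 := by
  set a : Fin N := ⟨1, by omega⟩
  obtain ⟨A, hsub, -, hcard⟩ := Finset.exists_subsuperset_card_eq
    (Finset.subset_univ (Finset.univ.filter fun p : Pair N => p.1.1 = a ∨ p.1.2 = a))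
    ((card_pairs_at_le a).trans hK1) (by rwa [Finset.card_univ, card_pair])
  have hA : ∀ p : Pair N, p.1.1 = a ∨ p.1.2 = a → p ∈ (A : Set (Pair N)) :=
    fun p hp => hsub (by simpa using hp)
  refine ⟨A, by rw [Set.ncard_coe_finset, hcard], hA, fun e he _ δ hδ => ?_⟩
  have hsol : IsSolution (show 0 < N by omega) A (fun p => Dmap δ p + e p) δ e :=
    ⟨hδ, he, fun _ => rfl⟩
  refine ⟨(δ, e), (δ + Pi.single a 1, e - Dmap (Pi.single a 1)), fun h => ?_, hsol,
    hsol.shift (by simp [a]) hA 1⟩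
  have h1 := congrFun (congrArg Prod.fst h) a
  simp at h1
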